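/- arXiv:2303.17821 — 2 statements merged into one kernel-verified Lean document; each statement's English description precedes it below -/
import Mathlib

section
/- For every real number v > 0, every integer k ≥ 2, and every complex number s with Re(s) > −1, the function t ↦ e^{−vt} t^{s−1} ((1+t)^{s+k−1} − 1) is integrable on the interval (0, ∞). -/
open MeasureTheory

open Asymptotics Filter Topology in
/-- As `t → 0⁺`, the difference `(1 + t) ^ w - 1` is `O(t)`. -/
lemma isBigO_one_add_cpow_sub_one_nhdsGT_zero (w : ℂ) :
    (fun t : ℝ => (1 + (t : ℂ)) ^ w - 1) =O[𝓝[>] 0] fun t : ℝ => t := by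
  have hd : HasDerivAt (fun z : ℂ => (1 + z) ^ w)
      (w * (1 + ((0 : ℝ) : ℂ)) ^ (w - 1) * 1) ((0 : ℝ) : ℂ) :=
    ((hasDerivAt_id _).const_add 1).cpow_const (by simp [Complex.slitPlane])
  simpa using hd.comp_ofReal.isBigO_sub.mono nhdsWithin_le_nhds

open Asymptotics Filter in
/-- Every complex power of `1 + t`, minus one, grows slower than any increasing exponential. -/
lemma isBigO_one_add_cpow_sub_one_atTop (w : ℂ) {b : ℝ} (hb : 0 < b) :
    (fun t : ℝ => (1 + (t : ℂ)) ^ w - 1) =O[atTop] fun t : ℝ => Real.exp (b * t) := by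
  refine IsBigO.sub ?_ ?_
  · have h := ((isLittleO_rpow_exp_pos_mul_atTop w.re hb).comp_tendsto
      (tendsto_atTop_add_const_left atTop (1 : ℝ) tendsto_id)).isBigO
    have hexp : (fun t : ℝ => Real.exp (b * (1 + t))) =O[atTop]
        fun t : ℝ => Real.exp (b * t) := by
      simpa only [mul_add, mul_one, Real.exp_add] using
        (isBigO_refl (fun t : ℝ => Real.exp (b * t)) atTop).const_mul_left (Real.exp b)
    refine (IsBigO.of_norm_eventuallyLE ?_).trans (h.trans hexp)
    filter_upwards [eventually_gt_atTop 0] with t ht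
    have h1 : 0 < 1 + t := by linarith
    simpa using (Complex.norm_cpow_eq_rpow_re_of_pos h1 w).le
  · refine IsBigO.of_bound 1 ?_
    filter_upwards [eventually_ge_atTop 0] with t ht
    simpa using mul_nonneg hb.le ht

open Asymptotics Filter Topology in
/-- For `v > 0`, an integer `k ≥ 2` and `s ∈ ℂ` with `Re(s) > -1`, the function
`t ↦ e^{-vt} t^{s-1} ((1+t)^{s+k-1} - 1)` is (Lebesgue) integrable on `(0, ∞)`. -/
theorem integrableOn_exp_cpow_mul (v : ℝ) (hv : 0 < v) (k : ℕ) (hk : 2 ≤ k) (s : ℂ)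
    (hs : -1 < s.re) :
    IntegrableOn
      (fun t : ℝ => Complex.exp (-v * t) * (t : ℂ) ^ (s - 1) *
        ((1 + (t : ℂ)) ^ (s + k - 1) - 1))
      (Set.Ioi (0 : ℝ)) := by
  set w : ℂ := s + k - 1
  have hexp (t : ℝ) : ‖Complex.exp (-v * t)‖ = Real.exp (-v * t) := by
    simp [Complex.norm_exp]
  have hcont : ContinuousOn
      (fun t : ℝ => Complex.exp (-v * t) * ((1 + (t : ℂ)) ^ w - 1)) (Set.Ioi 0) := by
    refine ContinuousOn.mul (by fun_prop) (ContinuousOn.sub ?_ continuousOn_const)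
    refine ContinuousOn.cpow_const (by fun_prop) fun t ht => Or.inl ?_
    have ht' : 0 < t := ht
    simpa using by linarith
  have htop : (fun t : ℝ => Complex.exp (-v * t) * ((1 + (t : ℂ)) ^ w - 1)) =O[atTop]
      fun t : ℝ => Real.exp (-(v / 2) * t) := by
    have he : (fun t : ℝ => Complex.exp (-v * t)) =O[atTop] fun t : ℝ => Real.exp (-v * t) :=
      IsBigO.of_norm_left (by simpa only [hexp] using isBigO_refl _ _)
    refine (he.mul (isBigO_one_add_cpow_sub_one_atTop w (half_pos hv))).congr_right fun t => ?_
    rw [← Real.exp_add]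
    ring_nf
  have hbot : (fun t : ℝ => Complex.exp (-v * t) * ((1 + (t : ℂ)) ^ w - 1)) =O[𝓝[>] 0]
      fun t : ℝ => t ^ (-(-1) : ℝ) := by
    have he : (fun t : ℝ => Complex.exp (-v * t)) =O[𝓝[>] 0] fun _ : ℝ => (1 : ℝ) := by
      refine IsBigO.of_bound 1 ?_
      filter_upwards [self_mem_nhdsWithin] with t ht
      have ht' : 0 < t := ht
      rw [hexp]
      simpa using (mul_pos hv ht').le
    simpa using he.mul (isBigO_one_add_cpow_sub_one_nhdsGT_zero w)
  have hmellin := mellinConvergent_of_isBigO_rpow_exp (half_pos hv)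
    (hcont.locallyIntegrableOn measurableSet_Ioi) htop hbot hs
  refine hmellin.congr_fun (fun t _ => ?_) measurableSet_Ioi
  simp only [smul_eq_mul]
  ring
end

section
/- The additive group (𝔞𝔡^{−1})/𝔞 is cyclic. -/
open NumberField
open scoped nonZeroDivisors

/-- The fractional ideal `𝔞𝔡⁻¹`, viewed as a `ℤ`-submodule of `K`. -/
noncomputable def aDualLattice (K : Type*) [Field K] [NumberField K]
    (𝔞 : FractionalIdeal (𝓞 K)⁰ K) : Submodule ℤ K :=
  Submodule.restrictScalars ℤ
    ((𝔞 * (↑(differentIdeal ℤ (𝓞 K)) : FractionalIdeal (𝓞 K)⁰ K)⁻¹ :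
      FractionalIdeal (𝓞 K)⁰ K) : Submodule (𝓞 K) K)

/-- The fractional ideal `𝔞`, viewed as a `ℤ`-submodule of `K`. -/
noncomputable def aLattice (K : Type*) [Field K] [NumberField K]
    (𝔞 : FractionalIdeal (𝓞 K)⁰ K) : Submodule ℤ K :=
  Submodule.restrictScalars ℤ (𝔞 : Submodule (𝓞 K) K)

/-- If `N` has full rank in a free `ℤ`-module `M` of rank two and the only `n` with `N ⊆ n M` is
`n = 1`, then `M ⧸ N` is cyclic. -/
theorem isAddCyclic_quotient_of_finrank_eq_two {M : Type*} [AddCommGroup M] [Module.Free ℤ M]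
    [Module.Finite ℤ M] (hM : Module.finrank ℤ M = 2) (N : Submodule ℤ M)
    (hN : Module.finrank ℤ N = Module.finrank ℤ M)
    (h : ∀ n : ℕ, (∀ x ∈ N, ∃ y : M, x = (n : ℤ) • y) → n = 1) :
    IsAddCyclic (M ⧸ N) := by
  obtain ⟨b, a, c, hc⟩ := Submodule.exists_smith_normal_form_of_rank_eq
    (Module.finBasisOfFinrankEq ℤ M hM) hN
  have hgcd : Int.gcd (a 0) (a 1) = 1 := by
    refine h _ fun x hx ↦ ?_
    obtain ⟨k, hk⟩ := Int.gcd_dvd_left (a 0) (a 1)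
    obtain ⟨l, hl⟩ := Int.gcd_dvd_right (a 0) (a 1)
    generalize (Int.gcd (a 0) (a 1) : ℤ) = g at *
    have hsum := congrArg Subtype.val (c.sum_repr ⟨x, hx⟩)
    simp only [Fin.sum_univ_two, Submodule.coe_add, Submodule.coe_smul, hc] at hsum
    refine ⟨(c.repr ⟨x, hx⟩ 0 * k) • b 0 + (c.repr ⟨x, hx⟩ 1 * l) • b 1, ?_⟩
    refine hsum.symm.trans ?_
    rw [hk, hl]
    module
  obtain ⟨u, v, huv⟩ := Int.isCoprime_iff_gcd_eq_one.mpr hgcd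
  have hmem (i : Fin 2) : a i • b i ∈ N := hc i ▸ (c i).2
  refine ⟨⟨N.mkQ (b 0 + b 1), fun q ↦ ?_⟩⟩
  obtain ⟨x, rfl⟩ := N.mkQ_surjective q
  obtain ⟨r, s, rfl⟩ : ∃ r s : ℤ, x = r • b 0 + s • b 1 :=
    ⟨_, _, by rw [← Fin.sum_univ_two fun i ↦ b.repr x i • b i, b.sum_repr]⟩
  refine ⟨r * (v * a 1) + s * (u * a 0), ?_⟩
  change _ • N.mkQ _ = _
  rw [← map_smul, ← sub_eq_zero, ← map_sub, Submodule.mkQ_apply, Submodule.Quotient.mk_eq_zero]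
  have key : (r * (v * a 1) + s * (u * a 0)) • (b 0 + b 1) - (r • b 0 + s • b 1) =
      ((s - r) * u) • a 0 • b 0 + ((r - s) * v) • a 1 • b 1 := by
    match_scalars
    · linear_combination r * huv
    · linear_combination s * huv
  rw [key]
  exact N.add_mem (N.smul_mem _ (hmem 0)) (N.smul_mem _ (hmem 1))

section

variable {K : Type*} [Field K] [NumberField K]

theorem differentIdeal_fractionalIdeal_ne_zero :
    (↑(differentIdeal ℤ (𝓞 K)) : FractionalIdeal (𝓞 K)⁰ K) ≠ 0 := by
  rw [coeIdeal_differentIdeal (K := ℚ)]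
  simp

/-- The trace of an element of the inverse different is an integer. -/
theorem exists_trace_eq_intCast_of_mem_inv_differentIdeal {y : K}
    (hy : y ∈ (↑(differentIdeal ℤ (𝓞 K)) : FractionalIdeal (𝓞 K)⁰ K)⁻¹) :
    ∃ m : ℤ, Algebra.trace ℚ K y = m := by
  rw [coeIdeal_differentIdeal (K := ℚ), inv_inv,
    FractionalIdeal.mem_dual (one_ne_zero (α := FractionalIdeal (𝓞 K)⁰ K))] at hy
  obtain ⟨m, hm⟩ := hy 1 (FractionalIdeal.one_mem_one _)
  exact ⟨m, by simpa using hm.symm⟩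

/-- In a quadratic field of odd discriminant, the inverse different contains `1 / n` only for
`n = 1`. -/
theorem eq_one_of_one_eq_mul_mem_inv_differentIdeal (h2 : Module.finrank ℚ K = 2)
    (hD : Odd (discr K)) {n : ℕ} {y : K}
    (hy : y ∈ (↑(differentIdeal ℤ (𝓞 K)) : FractionalIdeal (𝓞 K)⁰ K)⁻¹)
    (hny : 1 = (n : K) * y) : n = 1 := by
  have hn2 : n ∣ 2 := by
    obtain ⟨m, hm⟩ := exists_trace_eq_intCast_of_mem_inv_differentIdeal hy
    have htr := Algebra.trace_algebraMap (S := K) (1 : ℚ)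
    rw [map_one, hny, h2, ← nsmul_eq_mul, map_nsmul, hm] at htr
    have : (n : ℤ) * m = 2 := by
      have h : (n : ℚ) * m = 2 := by simpa using htr
      exact_mod_cast h
    exact_mod_cast Dvd.intro m this
  have hle : differentIdeal ℤ (𝓞 K) ≤ Ideal.span {(n : 𝓞 K)} := by
    intro x hx
    have hxy : (x : K) * y ∈ (1 : FractionalIdeal (𝓞 K)⁰ K) := by
      rw [← mul_inv_cancel₀ differentIdeal_fractionalIdeal_ne_zero]
      exact FractionalIdeal.mul_mem_mul (FractionalIdeal.mem_coeIdeal_of_mem _ hx) hy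
    obtain ⟨z, hz⟩ := (FractionalIdeal.mem_one_iff _).mp hxy
    refine Ideal.mem_span_singleton.mpr ⟨z, ?_⟩
    apply FaithfulSMul.algebraMap_injective (𝓞 K) K
    rw [map_mul, hz, map_natCast]
    linear_combination (x : K) * hny
  have hdvd := Ideal.absNorm_dvd_absNorm_of_le hle
  rw [Ideal.absNorm_span_natCast, RingOfIntegers.rank, h2, absNorm_differentIdeal (K := K)] at hdvd
  have hnD : n ∣ (discr K).natAbs := (dvd_pow_self n two_ne_zero).trans hdvd
  exact Nat.eq_one_of_dvd_coprimes (Int.natAbs_odd.mpr hD).coprime_two_left hn2 hnD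

theorem le_mul_inv_differentIdeal (𝔞 : FractionalIdeal (𝓞 K)⁰ K) :
    𝔞 ≤ 𝔞 * (↑(differentIdeal ℤ (𝓞 K)) : FractionalIdeal (𝓞 K)⁰ K)⁻¹ := by
  refine le_mul_of_one_le_right' ?_
  rw [coeIdeal_differentIdeal (K := ℚ), inv_inv]
  exact FractionalIdeal.one_le_dual_one ℤ ℚ

end

/-- The additive group `(𝔞𝔡⁻¹)/𝔞` is cyclic, for `𝔞` a nonzero fractional ideal of a real
quadratic field `K` of odd fundamental discriminant `D > 1`. -/
theorem isAddCyclic_dual_quotient (K : Type*) [Field K] [NumberField K]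
    (h2 : Module.finrank ℚ K = 2) (hD1 : 1 < NumberField.discr K)
    (hD : Odd (NumberField.discr K))
    (𝔞 : FractionalIdeal (𝓞 K)⁰ K) (h𝔞 : 𝔞 ≠ 0) :
    IsAddCyclic
      (↥(aDualLattice K 𝔞) ⧸
        (aLattice K 𝔞).comap (aDualLattice K 𝔞).subtype) := by
  set 𝔡 : FractionalIdeal (𝓞 K)⁰ K := ↑(differentIdeal ℤ (𝓞 K))
  have h𝔡0 : 𝔡 ≠ 0 := differentIdeal_fractionalIdeal_ne_zero
  have hle : aLattice K 𝔞 ≤ aDualLattice K 𝔞 := le_mul_inv_differentIdeal 𝔞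
  have hrank (I : FractionalIdeal (𝓞 K)⁰ K) (hI : I ≠ 0) :
      Module.finrank ℤ (aLattice K I) = 2 := by
    rw [← h2, ← RingOfIntegers.rank K]
    exact fractionalIdeal_rank K (Units.mk0 I hI)
  have hM : Module.finrank ℤ (aDualLattice K 𝔞) = 2 :=
    hrank (𝔞 * 𝔡⁻¹) (mul_ne_zero h𝔞 (inv_ne_zero h𝔡0))
  have : Module.Free ℤ (aDualLattice K 𝔞) :=
    inferInstanceAs (Module.Free ℤ (𝔞 * 𝔡⁻¹ : FractionalIdeal (𝓞 K)⁰ K))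
  have : Module.Finite ℤ (aDualLattice K 𝔞) :=
    inferInstanceAs (Module.Finite ℤ (𝔞 * 𝔡⁻¹ : FractionalIdeal (𝓞 K)⁰ K))
  refine isAddCyclic_quotient_of_finrank_eq_two hM _ ?_ fun n hn ↦ ?_
  · rw [(Submodule.comapSubtypeEquivOfLe hle).finrank_eq, hM, hrank 𝔞 h𝔞]
  · have hsub : 𝔞 ≤ FractionalIdeal.spanSingleton (𝓞 K)⁰ (n : K) * (𝔞 * 𝔡⁻¹) := by
      intro x hx
      obtain ⟨y, hy⟩ := hn ⟨x, hle hx⟩ hx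
      refine FractionalIdeal.mem_singleton_mul.mpr ⟨y, y.2, ?_⟩
      simpa using congrArg Subtype.val hy
    have hone : (1 : FractionalIdeal (𝓞 K)⁰ K) ≤
        FractionalIdeal.spanSingleton (𝓞 K)⁰ (n : K) * 𝔡⁻¹ := by
      have := mul_le_mul_right hsub 𝔞⁻¹
      rwa [inv_mul_cancel₀ h𝔞, mul_left_comm, inv_mul_cancel_left₀ h𝔞] at this
    obtain ⟨y, hy, hny⟩ := FractionalIdeal.mem_singleton_mul.mp
      (hone (FractionalIdeal.one_mem_one _))
    exact eq_one_of_one_eq_mul_mem_inv_differentIdeal h2 hD hy hny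
end
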